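/- Let N ≥ 1, let V : ℝ^N → ℝ^N be locally Lipschitz, and let f : ℝ^N → ℝ be continuously differentiable such that V is gradient-like for f: df_x(V(x)) > 0 whenever V(x) ≠ 0. Let K ⊆ ℝ^N be compact and let γ : [0, ∞) → K be differentiable with γ′(t) = V(γ(t)) for all t ≥ 0. Then every accumulation point of γ at infinity is a zero of V: if t_n → ∞ and γ(t_n) → p, then V(p) = 0. -/

import Mathlib

open Filter

/-- Let `V` be a locally Lipschitz vector field on `ℝ^N` that is gradient-like for a `C¹`
function `f` (i.e. `df_x(V(x)) > 0` whenever `V(x) ≠ 0`), and let `γ : [0, ∞) → K` be a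
trajectory of `V` contained in a compact set `K`. Then every accumulation point of `γ`
at infinity is a zero of `V`: if `t_n → ∞` and `γ(t_n) → p`, then `V(p) = 0`. -/
theorem stmt15 (N : ℕ) (hN : 1 ≤ N)
    (V : (Fin N → ℝ) → (Fin N → ℝ)) (hV : LocallyLipschitz V)
    (f : (Fin N → ℝ) → ℝ) (hf : ContDiff ℝ 1 f)
    (hgrad : ∀ x, V x ≠ 0 → 0 < fderiv ℝ f x (V x))
    (K : Set (Fin N → ℝ)) (hK : IsCompact K)
    (γ : ℝ → Fin N → ℝ)
    (hγK : ∀ t : ℝ, 0 ≤ t → γ t ∈ K)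
    (hγ : ∀ t : ℝ, 0 ≤ t → HasDerivAt γ (V (γ t)) t)
    (p : Fin N → ℝ) (ts : ℕ → ℝ)
    (hts : Tendsto ts atTop atTop)
    (hlim : Tendsto (fun n => γ (ts n)) atTop (nhds p)) :
    V p = 0 := by
  set g : (Fin N → ℝ) → ℝ := fun x => fderiv ℝ f x (V x) with hg
  have hgc : Continuous g := (hf.continuous_fderiv one_ne_zero).clm_apply hV.continuous
  have hg0 : ∀ x, 0 ≤ g x := by
    intro x
    by_cases hx : V x = 0
    · simp [hg, hx]
    · exact (hgrad x hx).le
  have hF : ∀ t : ℝ, 0 ≤ t → HasDerivAt (f ∘ γ) (g (γ t)) t := fun t ht =>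
    ((hf.differentiable one_ne_zero) (γ t)).hasFDerivAt.comp_hasDerivAt t (hγ t ht)
  have hgrowth : ∀ c a b : ℝ, 0 ≤ a → a ≤ b → (∀ s ∈ Set.Icc a b, c ≤ g (γ s)) →
      c * (b - a) ≤ f (γ b) - f (γ a) := by
    intro c a b ha hab hc
    have hs : ∀ s ∈ Set.Icc a b, HasDerivAt (f ∘ γ) (g (γ s)) s :=
      fun s hs => hF s (ha.trans hs.1)
    refine (convex_Icc a b).mul_sub_le_image_sub_of_le_deriv
      (fun s h => (hs s h).continuousAt.continuousWithinAt)
      (fun s h => (hs s (interior_subset h)).differentiableAt.differentiableWithinAt)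
      (fun s h => ?_) a (Set.left_mem_Icc.2 hab) b (Set.right_mem_Icc.2 hab) hab
    rw [(hs s (interior_subset h)).deriv]
    exact hc s (interior_subset h)
  have hflim : Tendsto (fun n => f (γ (ts n))) atTop (nhds (f p)) :=
    (hf.continuous.tendsto p).comp hlim
  have hle : ∀ t : ℝ, 0 ≤ t → f (γ t) ≤ f p := by
    intro t ht
    refine ge_of_tendsto hflim ?_
    filter_upwards [hts.eventually_ge_atTop t] with n hn
    have := hgrowth 0 t (ts n) ht hn fun s _ => hg0 _
    linarith
  obtain ⟨M, hM⟩ := hK.exists_bound_of_continuousOn hV.continuous.continuousOn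
  have hMγ : ∀ a b : ℝ, 0 ≤ a → 0 ≤ b → ‖γ b - γ a‖ ≤ M * ‖b - a‖ := fun a b ha hb =>
    (convex_Ici (0 : ℝ)).norm_image_sub_le_of_norm_hasDerivWithin_le
      (fun s hs => (hγ s hs).hasDerivWithinAt) (fun s hs => hM _ (hγK s hs)) ha hb
  by_contra hp
  have hgp : 0 < g p := hgrad p hp
  obtain ⟨r, hr, hball⟩ := Metric.eventually_nhds_iff.1
    (hgc.continuousAt.eventually_const_lt (half_lt_self hgp))
  set δ : ℝ := r / 2 / (|M| + 1) with hδ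
  have hδ0 : 0 < δ := by positivity
  have hδM : M * δ ≤ r / 2 := by
    have h : (|M| + 1) * δ = r / 2 := by rw [hδ]; field_simp
    nlinarith [le_abs_self M]
  have hstep : ∀ᶠ n in atTop, f (γ (ts n)) ≤ f p - g p / 2 * δ := by
    filter_upwards [hts.eventually_ge_atTop 0, Metric.tendsto_nhds.1 hlim (r / 2) (half_pos hr)]
      with n hn hd
    have h := hgrowth (g p / 2) (ts n) (ts n + δ) hn (by linarith) fun s hs => by
      refine (hball ?_).le
      have h0 : 0 ≤ s - ts n := sub_nonneg.2 hs.1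
      have h1 := hMγ (ts n) s hn (hn.trans hs.1)
      have hM0 : 0 ≤ M := (norm_nonneg _).trans (hM _ (hγK _ hn))
      rw [Real.norm_of_nonneg h0, ← dist_eq_norm] at h1
      have h2 : M * (s - ts n) ≤ M * δ :=
        mul_le_mul_of_nonneg_left (by linarith [hs.2]) hM0
      linarith [dist_triangle (γ s) (γ (ts n)) p]
    have := hle (ts n + δ) (by linarith)
    rw [add_sub_cancel_left] at h
    linarith
  have := le_of_tendsto hflim hstep
  have : 0 < g p / 2 * δ := by positivity
  linarith
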